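/- Let γ denote the Euler–Mascheroni constant, let ψ denote the digamma function (the logarithmic derivative of the Gamma function), and for real n > 1 define Q(n) := exp(iπn)·exp(−4πi(γ + ψ(n+1)))·(exp(2πi/n) + (exp(2πi/n)+1)/(exp(2πi/n)−1)). Then the limit of the real part Re(Q(n)) as n → 1 from the right exists and equals 4(1 − π²/6). -/

import Mathlib

open Real Filter Topology

/-- The digamma function: the logarithmic derivative of the Gamma function. -/
noncomputable def digamma (x : ℝ) : ℝ := deriv (fun y : ℝ => Real.log (Real.Gamma y)) x

/-- The analytic continuation `Q(n) = Q_L(n)` of the vertex-to-center displacement of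
the telescoping spiral. -/
noncomputable def Q (n : ℝ) : ℂ :=
  Complex.exp (Complex.I * (π : ℂ) * (n : ℂ)) *
    Complex.exp (-4 * (π : ℂ) * Complex.I *
      ((Real.eulerMascheroniConstant + digamma (n + 1) : ℝ) : ℂ)) *
    (Complex.exp (2 * (π : ℂ) * Complex.I / (n : ℂ)) +
      (Complex.exp (2 * (π : ℂ) * Complex.I / (n : ℂ)) + 1) /
        (Complex.exp (2 * (π : ℂ) * Complex.I / (n : ℂ)) - 1))

theorem differentiableAt_log_Gamma {x : ℝ} (hx : 0 < x) :
    DifferentiableAt ℝ (fun y : ℝ => Real.log (Real.Gamma y)) x := by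
  refine (Real.differentiableAt_Gamma fun m => ?_).log (Real.Gamma_pos_of_pos hx).ne'
  have : (0 : ℝ) ≤ m := m.cast_nonneg
  linarith

theorem monotoneOn_digamma : MonotoneOn digamma (Set.Ioi 0) :=
  Real.convexOn_log_Gamma.monotoneOn_deriv fun _ hx => differentiableAt_log_Gamma hx

theorem digamma_add_one {x : ℝ} (hx : 0 < x) : digamma (x + 1) = digamma x + x⁻¹ := by
  have h : (fun y : ℝ => Real.log (Real.Gamma (y + 1))) =ᶠ[𝓝 x]
      fun y => Real.log (Real.Gamma y) + Real.log y := by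
    filter_upwards [lt_mem_nhds hx] with y hy
    rw [Real.Gamma_add_one hy.ne', Real.log_mul hy.ne' (Real.Gamma_pos_of_pos hy).ne', add_comm]
  unfold digamma
  rw [← deriv_comp_add_const (fun y : ℝ => Real.log (Real.Gamma y)), h.deriv_eq,
    deriv_fun_add (differentiableAt_log_Gamma hx) (Real.differentiableAt_log hx.ne'),
    Real.deriv_log]

theorem digamma_add_nat {x : ℝ} (hx : 0 < x) (N : ℕ) :
    digamma (x + N) = digamma x + ∑ k ∈ Finset.range N, (x + k)⁻¹ := by
  induction N with
  | zero => simp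
  | succ N ih =>
    rw [Finset.sum_range_succ, Nat.cast_succ, ← add_assoc, digamma_add_one (by positivity), ih,
      add_assoc]

theorem digamma_two : digamma 2 = 1 - Real.eulerMascheroniConstant := by
  have h := Real.hasDerivAt_Gamma_nat 1
  norm_num at h
  have h2 := h.log (by norm_num)
  unfold digamma
  rw [h2.deriv]
  norm_num
  ring

theorem hasSum_digamma_sub_digamma_two {x : ℝ} (h1 : 1 < x) (h3 : x < 3) :
    HasSum (fun k : ℕ => (x - 2) * ((2 + k : ℝ)⁻¹ * (x + k)⁻¹)) (digamma x - digamma 2) := by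
  have hx : 0 < x := by linarith
  have hs : Summable fun k : ℕ => (x - 2) * ((2 + k : ℝ)⁻¹ * (x + k)⁻¹) := by
    refine Summable.mul_left _ ?_
    refine Summable.of_nonneg_of_le (fun k => by positivity) (fun k => ?_)
      ((summable_nat_add_iff 1).2 (Real.summable_nat_pow_inv.2 one_lt_two))
    rw [← mul_inv]
    refine inv_anti₀ (by positivity) ?_
    push_cast
    have : (0 : ℝ) ≤ k := k.cast_nonneg
    nlinarith
  refine hs.hasSum_iff_tendsto_nat.2 ?_
  have key : ∀ N : ℕ, ∑ k ∈ Finset.range N, (x - 2) * ((2 + k : ℝ)⁻¹ * (x + k)⁻¹) =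
      digamma x - digamma 2 - (digamma (x + N) - digamma (2 + N)) := by
    intro N
    rw [digamma_add_nat hx, digamma_add_nat two_pos]
    have : ∀ k : ℕ, (x - 2) * ((2 + k : ℝ)⁻¹ * (x + k)⁻¹) = (2 + k : ℝ)⁻¹ - (x + k)⁻¹ := by
      intro k
      have : (2 + k : ℝ) ≠ 0 := by positivity
      have : x + k ≠ 0 := by positivity
      field_simp
      ring
    simp only [this, Finset.sum_sub_distrib]
    ring
  simp only [key]
  have hlim : Tendsto (fun N : ℕ => digamma (x + N) - digamma (2 + N)) atTop (𝓝 0) := by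
    have hb : Tendsto (fun N : ℕ => 2 * (1 / ((N : ℝ) + 1))) atTop (𝓝 0) := by
      simpa using tendsto_one_div_add_atTop_nhds_zero_nat.const_mul (2 : ℝ)
    refine squeeze_zero_norm (fun N => ?_) hb
    have hN : (0 : ℝ) ≤ N := N.cast_nonneg
    have m : ∀ {a b : ℝ}, 0 < a → a ≤ b → digamma a ≤ digamma b := fun ha hab =>
      monotoneOn_digamma ha (ha.trans_le hab) hab
    have e1 := digamma_add_one (x := 1 + N) (by positivity)
    have e2 := digamma_add_one (x := 1 + N + 1) (by positivity)
    have a1 := m (a := 1 + N) (b := x + N) (by positivity) (by linarith)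
    have a2 := m (a := x + N) (b := 1 + N + 1 + 1) (by positivity) (by linarith)
    have i1 : ((1 : ℝ) + N + 1)⁻¹ ≤ (1 + N : ℝ)⁻¹ := inv_anti₀ (by positivity) (by linarith)
    have i2 : 0 < ((1 : ℝ) + N + 1)⁻¹ := by positivity
    rw [show (2 + N : ℝ) = 1 + N + 1 by ring, Real.norm_eq_abs, abs_le, one_div,
      add_comm (N : ℝ) 1]
    constructor <;> linarith
  simpa using hlim.const_sub (digamma x - digamma 2)

theorem hasSum_inv_two_add_nat_sq :
    HasSum (fun k : ℕ => (2 + k : ℝ)⁻¹ * (2 + k : ℝ)⁻¹) (π ^ 2 / 6 - 1) := by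
  have h := (hasSum_nat_add_iff' 2).2 hasSum_zeta_two
  have hsum : ∑ i ∈ Finset.range 2, 1 / (i : ℝ) ^ 2 = 1 := by simp [Finset.sum_range_succ]
  rw [hsum] at h
  refine h.congr_fun fun k => ?_
  push_cast
  rw [one_div, sq, mul_inv, add_comm]

theorem hasDerivAt_digamma_two : HasDerivAt digamma (π ^ 2 / 6 - 1) 2 := by
  rw [hasDerivAt_iff_tendsto_slope]
  have hnear : ∀ᶠ x : ℝ in 𝓝[≠] 2, 1 < x ∧ x < 3 :=
    nhdsWithin_le_nhds (Ioo_mem_nhds (by norm_num) (by norm_num))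
  have heq : (fun x : ℝ => ∑' k : ℕ, (2 + k : ℝ)⁻¹ * (x + k)⁻¹) =ᶠ[𝓝[≠] 2] slope digamma 2 := by
    filter_upwards [hnear, self_mem_nhdsWithin] with x hx hne
    have hne' : x - 2 ≠ 0 := sub_ne_zero.2 hne
    rw [slope_def_field, ← (hasSum_digamma_sub_digamma_two hx.1 hx.2).tsum_eq, tsum_mul_left,
      mul_div_cancel_left₀ _ hne']
  refine Tendsto.congr' heq ?_
  rw [← hasSum_inv_two_add_nat_sq.tsum_eq]
  refine tendsto_tsum_of_dominated_convergence
    ((summable_nat_add_iff 1).2 (Real.summable_nat_pow_inv.2 one_lt_two)) (fun k => ?_) ?_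
  · have hk : (2 + k : ℝ) ≠ 0 := by positivity
    have : ContinuousAt (fun x : ℝ => (2 + k : ℝ)⁻¹ * (x + k)⁻¹) 2 := by fun_prop (disch := exact hk)
    exact this.tendsto.mono_left nhdsWithin_le_nhds
  · filter_upwards [hnear] with x hx k
    have hx0 : 0 < x := by linarith [hx.1]
    rw [Real.norm_of_nonneg (by positivity), ← mul_inv]
    refine inv_anti₀ (by positivity) ?_
    push_cast
    have : (0 : ℝ) ≤ k := k.cast_nonneg
    nlinarith [hx.1]

/-- The argument of the unimodular prefactor of `Q n`. -/
noncomputable def phase (n : ℝ) : ℝ :=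
  π * n - 4 * π * (Real.eulerMascheroniConstant + digamma (n + 1))

theorem phase_one : phase 1 = π - 2 * (2 * π) := by
  rw [phase, one_add_one_eq_two, digamma_two]
  ring

theorem hasDerivAt_phase_one : HasDerivAt phase (π - 4 * π * (π ^ 2 / 6 - 1)) 1 := by
  have h : HasDerivAt (fun n : ℝ => digamma (n + 1)) (π ^ 2 / 6 - 1) 1 := by
    refine HasDerivAt.comp_add_const 1 1 ?_
    rw [one_add_one_eq_two]
    exact hasDerivAt_digamma_two
  refine HasDerivAt.sub ?_ ((h.const_add Real.eulerMascheroniConstant).const_mul (4 * π))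
  simpa using (hasDerivAt_id (1 : ℝ)).const_mul π

theorem exp_add_one_div_exp_sub_one {t : ℝ} (ht : Real.sin t ≠ 0) :
    (Complex.exp (2 * t * Complex.I) + 1) / (Complex.exp (2 * t * Complex.I) - 1) =
      ((-(Real.cos t / Real.sin t) : ℝ) : ℂ) * Complex.I := by
  have hs : (Complex.sin t) ≠ 0 := by exact_mod_cast ht
  have h1 : Complex.exp (2 * t * Complex.I) =
      (Complex.cos t + Complex.sin t * Complex.I) ^ 2 := by
    rw [← Complex.exp_mul_I, ← Complex.exp_nat_mul]
    congr 1
    push_cast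
    ring
  have hp := Complex.sin_sq_add_cos_sq (t : ℂ)
  have hne : Complex.cos t + Complex.sin t * Complex.I ≠ 0 := by
    rw [← Complex.exp_mul_I]
    exact Complex.exp_ne_zero _
  have h2 : (Complex.cos t + Complex.sin t * Complex.I) ^ 2 - 1 =
      2 * Complex.I * Complex.sin t * (Complex.cos t + Complex.sin t * Complex.I) := by
    linear_combination hp - Complex.sin t ^ 2 * Complex.I_sq
  have h3 : (Complex.cos t + Complex.sin t * Complex.I) ^ 2 + 1 =
      2 * Complex.cos t * (Complex.cos t + Complex.sin t * Complex.I) := by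
    linear_combination Complex.sin t ^ 2 * Complex.I_sq - hp
  rw [h1, h2, h3]
  push_cast
  field_simp
  linear_combination (Complex.cos t) * Complex.I_sq

theorem Q_re_eq {n : ℝ} (hn : Real.sin (π / n) ≠ 0) :
    (Q n).re = Real.cos (phase n + 2 * (π / n)) +
      Real.cos (π / n) * (Real.sin (phase n) / Real.sin (π / n)) := by
  have e1 : (2 * (π : ℂ) * Complex.I / (n : ℂ)) = 2 * ((π / n : ℝ) : ℂ) * Complex.I := by
    push_cast
    ring
  have e2 : Complex.exp (Complex.I * (π : ℂ) * (n : ℂ)) *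
      Complex.exp (-4 * (π : ℂ) * Complex.I *
        ((Real.eulerMascheroniConstant + digamma (n + 1) : ℝ) : ℂ)) =
      Complex.exp ((phase n : ℝ) * Complex.I) := by
    rw [← Complex.exp_add, phase]
    congr 1
    push_cast
    ring
  have e3 : Complex.exp ((phase n : ℝ) * Complex.I) *
      Complex.exp (2 * ((π / n : ℝ) : ℂ) * Complex.I) =
      Complex.exp ((phase n + 2 * (π / n) : ℝ) * Complex.I) := by
    rw [← Complex.exp_add]
    congr 1
    push_cast
    ring
  rw [Q, e2, e1, exp_add_one_div_exp_sub_one hn, mul_add, e3, Complex.add_re,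
    Complex.exp_ofReal_mul_I_re, mul_left_comm, Complex.re_ofReal_mul, Complex.mul_I_re,
    Complex.exp_ofReal_mul_I_im]
  ring

theorem Q_re_limit_at_one :
    Tendsto (fun n : ℝ => (Q n).re) (𝓝[>] (1 : ℝ)) (𝓝 (4 * (1 - π ^ 2 / 6))) := by
  have hle : 𝓝[>] (1 : ℝ) ≤ 𝓝[≠] 1 := nhdsWithin_mono _ fun _ hx => ne_of_gt hx
  have hdiv : HasDerivAt (fun n : ℝ => π / n) (-π) 1 := by
    simpa [div_eq_mul_inv] using (hasDerivAt_inv (one_ne_zero (α := ℝ))).const_mul π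
  have hsin : HasDerivAt (fun n : ℝ => Real.sin (π / n)) π 1 := by
    simpa using hdiv.sin
  have hphase : HasDerivAt (fun n : ℝ => Real.sin (phase n))
      (-(π - 4 * π * (π ^ 2 / 6 - 1))) 1 := by
    have h := hasDerivAt_phase_one.sin
    rw [phase_one, show π - 2 * (2 * π) = π - (2 : ℕ) * (2 * π) by norm_num,
      Real.cos_sub_nat_mul_two_pi, Real.cos_pi, neg_one_mul] at h
    exact h
  have hsin_one : Real.sin (phase 1) = 0 := by
    rw [phase_one, show π - 2 * (2 * π) = π - (2 : ℕ) * (2 * π) by norm_num,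
      Real.sin_sub_nat_mul_two_pi, Real.sin_pi]
  have hquot : Tendsto (fun n : ℝ => Real.sin (phase n) / Real.sin (π / n)) (𝓝[>] 1)
      (𝓝 (-(π - 4 * π * (π ^ 2 / 6 - 1)) / π)) := by
    have h := ((hasDerivAt_iff_tendsto_slope.1 hphase).div
      (hasDerivAt_iff_tendsto_slope.1 hsin) Real.pi_ne_zero).mono_left hle
    refine h.congr' ?_
    filter_upwards [self_mem_nhdsWithin] with n hn
    have : n - 1 ≠ 0 := sub_ne_zero.2 (ne_of_gt hn)
    simp only [Pi.div_apply, slope_def_field, hsin_one, div_one, Real.sin_pi, sub_zero]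
    exact div_div_div_cancel_right₀ this _ _
  have hcos : Tendsto (fun n : ℝ => Real.cos (π / n)) (𝓝[>] 1) (𝓝 (-1)) := by
    simpa using (hdiv.cos.continuousAt.tendsto).mono_left (nhdsWithin_le_nhds (s := Set.Ioi 1))
  have hfirst : Tendsto (fun n : ℝ => Real.cos (phase n + 2 * (π / n))) (𝓝[>] 1) (𝓝 (-1)) := by
    have h := ((hasDerivAt_phase_one.add (hdiv.const_mul 2)).cos.continuousAt.tendsto).mono_left
      (nhdsWithin_le_nhds (s := Set.Ioi 1))
    have hval : Real.cos (phase 1 + 2 * (π / 1)) = -1 := by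
      rw [phase_one, show π - 2 * (2 * π) + 2 * (π / 1) = π - 2 * π by ring,
        Real.cos_sub_two_pi, Real.cos_pi]
    simpa only [Pi.add_apply, hval] using h
  have hlim := hfirst.add (hcos.mul hquot)
  have hval : -1 + -1 * (-(π - 4 * π * (π ^ 2 / 6 - 1)) / π) = 4 * (1 - π ^ 2 / 6) := by
    field_simp
    ring
  rw [hval] at hlim
  refine hlim.congr' ?_
  filter_upwards [self_mem_nhdsWithin] with n hn
  have hn1 : (1 : ℝ) < n := hn
  have hn0 : 0 < n := by linarith
  exact (Q_re_eq (Real.sin_pos_of_pos_of_lt_pi (by positivity)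
    (div_lt_self Real.pi_pos hn1)).ne').symm
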